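/- Assume each I_j is a closed interval and co(S, 𝒥_S) is bounded. Let n = ⌊m/2⌋ + 1. Then co(S, 𝒥_S) is the convex hull of at most n·C(m, n) points; that is, there exists a finite set F ⊆ L with at most n·(m choose n) elements such that co(S, 𝒥_S) = conv F. -/

import Mathlib

namespace CIH

/-- Vertex sum of the box. -/
noncomputable def vs {m : ℕ} (a b : Fin m → ℝ) (A : Finset (Fin m)) : ℝ :=
  ∑ i, if i ∈ A then b i else a i

lemma vs_insert {m : ℕ} (a b : Fin m → ℝ) (A : Finset (Fin m)) (j : Fin m) (hj : j ∉ A) :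
    vs a b (insert j A) = vs a b A + (b j - a j) := by
  unfold vs
  rw [← Finset.add_sum_erase _ _ (Finset.mem_univ j),
    ← Finset.add_sum_erase (a := j) Finset.univ (fun i => if i ∈ A then b i else a i)
      (Finset.mem_univ j)]
  have : ∑ i ∈ Finset.univ.erase j, (if i ∈ insert j A then b i else a i)
      = ∑ i ∈ Finset.univ.erase j, (if i ∈ A then b i else a i) := by
    apply Finset.sum_congr rfl
    intro i hi
    have : i ≠ j := Finset.ne_of_mem_erase hi
    simp [Finset.mem_insert, this]
  rw [this]
  simp [hj]
  ring

/-- Boundary edges of a family of sets. -/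
def edges {m : ℕ} (D : Finset (Finset (Fin m))) : Finset (Finset (Fin m) × Fin m) :=
  Finset.univ.filter (fun p => p.1 ∈ D ∧ p.2 ∉ p.1 ∧ insert p.2 p.1 ∉ D)

lemma card_edges {m : ℕ} (D : Finset (Finset (Fin m)))
    (hD : ∀ A j, j ∉ A → insert j A ∈ D → A ∈ D) :
    ((edges D).card : ℤ) = ∑ A ∈ D, ((m : ℤ) - 2 * A.card) := by
  classical
  let U : Finset (Finset (Fin m) × Fin m) :=
    Finset.univ.filter (fun p => p.1 ∈ D ∧ p.2 ∉ p.1)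
  let V : Finset (Finset (Fin m) × Fin m) :=
    Finset.univ.filter (fun p => p.1 ∈ D ∧ p.2 ∈ p.1)
  have hU : (U.card : ℤ) = ∑ A ∈ D, ((m : ℤ) - A.card) := by
    have h : U.card = ∑ A ∈ D, (Aᶜ).card := by
      rw [← Finset.card_sigma]
      refine Finset.card_bij (fun p _ => ⟨p.1, p.2⟩) ?_ ?_ ?_
      · intro p hp; simpa [U] using hp
      · rintro ⟨p, q⟩ _ ⟨p', q'⟩ _ h; simpa using h
      · rintro ⟨A, j⟩ h; exact ⟨(A, j), by simpa [U] using h, rfl⟩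
    rw [h]
    push_cast
    apply Finset.sum_congr rfl
    intro A _
    rw [Finset.card_compl, Nat.cast_sub (Finset.card_le_univ A)]
    simp
  have hV : (V.card : ℤ) = ∑ A ∈ D, (A.card : ℤ) := by
    have h : V.card = ∑ A ∈ D, A.card := by
      rw [← Finset.card_sigma]
      refine Finset.card_bij (fun p _ => ⟨p.1, p.2⟩) ?_ ?_ ?_
      · intro p hp; simpa [V] using hp
      · rintro ⟨p, q⟩ _ ⟨p', q'⟩ _ h; simpa using h
      · rintro ⟨A, j⟩ h; exact ⟨(A, j), by simpa [V] using h, rfl⟩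
    rw [h]
    push_cast
    rfl
  have hE : U.card = (edges D).card + V.card := by
    rw [← Finset.card_filter_add_card_filter_not (s := U) (fun p => insert p.2 p.1 ∉ D)]
    congr 1
    · congr 1
      ext p
      simp [U, edges, and_assoc]
    · refine Finset.card_bij (fun p _ => (insert p.2 p.1, p.2)) ?_ ?_ ?_
      · intro p hp
        simp only [U, V, Finset.mem_filter, Finset.mem_univ, true_and, not_not] at hp ⊢
        exact ⟨hp.2, Finset.mem_insert_self _ _⟩
      · rintro ⟨A, j⟩ h ⟨A', j'⟩ h' e
        simp only [U, Finset.mem_filter, Finset.mem_univ, true_and, not_not] at h h'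
        simp only [Prod.mk.injEq] at e
        obtain ⟨e, rfl⟩ := e
        have := congrArg (fun s => Finset.erase s j) e
        simp only [Finset.erase_insert h.1.2, Finset.erase_insert h'.1.2] at this
        rw [this]
      · rintro ⟨B, j⟩ h
        simp only [V, Finset.mem_filter, Finset.mem_univ, true_and] at h
        refine ⟨(B.erase j, j), ?_, ?_⟩
        · simp only [U, Finset.mem_filter, Finset.mem_univ, true_and, not_not,
            Finset.insert_erase h.2]
          exact ⟨⟨hD _ j (Finset.notMem_erase _ _) (by rw [Finset.insert_erase h.2]; exact h.1),
            Finset.notMem_erase _ _⟩, h.1⟩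
        · simp [Finset.insert_erase h.2]
  have : ((edges D).card : ℤ) = U.card - V.card := by rw [hE]; push_cast; ring
  rw [this, hU, hV, ← Finset.sum_sub_distrib]
  apply Finset.sum_congr rfl
  intros; ring

lemma telescope (m N : ℕ) :
    ∑ k ∈ Finset.range N, (m.choose k : ℤ) * ((m : ℤ) - 2 * k) = N * m.choose N := by
  induction N with
  | zero => simp
  | succ N ih =>
    rw [Finset.sum_range_succ, ih]
    have h := Nat.choose_succ_right_eq m N
    have h2 : (m.choose (N+1) : ℤ) * (N + 1) = m.choose N * ((m : ℤ) - N) := by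
      rcases le_or_gt N m with hN | hN
      · have : ((m - N : ℕ) : ℤ) = (m : ℤ) - N := Nat.cast_sub hN
        rw [← this]; exact_mod_cast h
      · simp [Nat.choose_eq_zero_of_lt hN, Nat.choose_eq_zero_of_lt (Nat.lt_succ_of_lt hN)]
    push_cast
    linear_combination -h2

lemma card_edges_le {m : ℕ} (D : Finset (Finset (Fin m)))
    (hD : ∀ A j, j ∉ A → insert j A ∈ D → A ∈ D) :
    (edges D).card ≤ (m / 2 + 1) * m.choose (m / 2 + 1) := by
  classical
  have h : ((edges D).card : ℤ) ≤ ((m / 2 + 1 : ℕ) : ℤ) * m.choose (m / 2 + 1) := by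
    rw [card_edges D hD, ← telescope]
    let T : Finset (Finset (Fin m)) := Finset.univ.filter (fun A => A.card ∈ Finset.range (m/2+1))
    have hT : ∑ k ∈ Finset.range (m / 2 + 1), (m.choose k : ℤ) * ((m : ℤ) - 2 * k)
        = ∑ A ∈ T, ((m : ℤ) - 2 * A.card) := by
      rw [← Finset.sum_fiberwise_of_maps_to (s := T) (t := Finset.range (m/2+1))
        (g := Finset.card) (fun A hA => (Finset.mem_filter.1 hA).2)]
      apply Finset.sum_congr rfl
      intro k hk
      have e : T.filter (fun A => A.card = k) = Finset.powersetCard k Finset.univ := by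
        ext A
        simp only [T, Finset.mem_filter, Finset.mem_univ, true_and, Finset.mem_powersetCard,
          Finset.subset_univ]
        constructor
        · exact fun h => h.2
        · intro h; exact ⟨h ▸ hk, h⟩
      rw [e, Finset.sum_congr rfl (g := fun _ => (m : ℤ) - 2 * k)]
      · simp [mul_sub]
      · intro A hA; rw [(Finset.mem_powersetCard.1 hA).2]
    rw [hT]
    calc ∑ A ∈ D, ((m : ℤ) - 2 * A.card)
        ≤ ∑ A ∈ D.filter (fun A => A ∈ T), ((m : ℤ) - 2 * A.card) := by
          rw [← Finset.sum_filter_add_sum_filter_not D (fun A => A ∈ T)]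
          have : ∑ A ∈ D.filter (fun A => A ∉ T), ((m : ℤ) - 2 * A.card) ≤ 0 := by
            apply Finset.sum_nonpos
            intro A hA
            simp [T] at hA
            omega
          linarith
      _ ≤ ∑ A ∈ T, ((m : ℤ) - 2 * A.card) := by
          apply Finset.sum_le_sum_of_subset_of_nonneg
          · intro A hA; exact (Finset.mem_filter.1 hA).2
          · intro A hA _
            simp [T] at hA
            omega
  exact_mod_cast h

/-- The parameter polytope. -/
def P {m : ℕ} (a b : Fin m → ℝ) : Set (Fin m → ℝ) :=
  {ξ | (∀ j, ξ j ∈ Set.Icc (a j) (b j)) ∧ (∑ j, ξ j) = 1}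

lemma P_eq {m : ℕ} (a b : Fin m → ℝ) :
    P a b = Set.Icc a b ∩ {ξ | (∑ j, ξ j) = 1} := by
  ext ξ
  simp [P, Pi.le_def, forall_and]

lemma P_compact {m : ℕ} (a b : Fin m → ℝ) : IsCompact (P a b) := by
  rw [P_eq]
  exact isCompact_Icc.inter_right (isClosed_eq (by fun_prop) continuous_const)

lemma P_convex {m : ℕ} (a b : Fin m → ℝ) : Convex ℝ (P a b) := by
  rw [P_eq]
  refine (convex_Icc a b).inter ?_
  intro u hu v hv s t hs ht hst
  simp only [Set.mem_ofPred_eq] at hu hv ⊢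
  simp [Finset.sum_add_distrib, ← Finset.mul_sum, hu, hv, hst]

lemma P_eq_hull {m : ℕ} (a b : Fin m → ℝ) (F : Finset (Fin m → ℝ))
    (h1 : (F : Set (Fin m → ℝ)) ⊆ P a b) (h2 : (P a b).extremePoints ℝ ⊆ F) :
    P a b = convexHull ℝ (F : Set (Fin m → ℝ)) := by
  apply Set.Subset.antisymm
  · rw [← closure_convexHull_extremePoints (P_compact a b) (P_convex a b)]
    exact closure_minimal (convexHull_mono h2) (F.finite_toSet.isClosed_convexHull ℝ)
  · exact convexHull_min h1 (P_convex a b)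

lemma extreme_interior {m : ℕ} (a b : Fin m → ℝ) (ξ : Fin m → ℝ)
    (h : ξ ∈ (P a b).extremePoints ℝ) (i k : Fin m)
    (hi : a i < ξ i ∧ ξ i < b i) (hk : a k < ξ k ∧ ξ k < b k) : i = k := by
  by_contra hik
  obtain ⟨ε, hε, h1, h2, h3, h4⟩ : ∃ ε : ℝ, 0 < ε ∧ ε ≤ ξ i - a i ∧ ε ≤ b i - ξ i ∧
      ε ≤ ξ k - a k ∧ ε ≤ b k - ξ k := by
    refine ⟨min (min (ξ i - a i) (b i - ξ i)) (min (ξ k - a k) (b k - ξ k)), ?_, ?_, ?_, ?_, ?_⟩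
    · simp [hi, hk]
    · exact (min_le_left _ _).trans (min_le_left _ _)
    · exact (min_le_left _ _).trans (min_le_right _ _)
    · exact (min_le_right _ _).trans (min_le_left _ _)
    · exact (min_le_right _ _).trans (min_le_right _ _)
  have key : ∀ s : ℝ, |s| ≤ ε → ξ + (Pi.single i s - Pi.single k s) ∈ P a b := by
    intro s hs
    rw [abs_le] at hs
    refine ⟨fun j => ?_, ?_⟩
    · have := h.1.1 j
      rw [Set.mem_Icc] at this ⊢
      by_cases hji : j = i
      · subst hji
        simp [Pi.single_apply, hik]
        constructor <;> linarith
      · by_cases hjk : j = k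
        · subst hjk
          simp [Pi.single_apply, hji]
          constructor <;> linarith
        · simpa [Pi.single_apply, hji, hjk] using this
    · have := h.1.2
      simp [Finset.sum_add_distrib, Finset.sum_sub_distrib, this]
  have e1 := key ε (by rw [abs_of_pos hε])
  have e2 := key (-ε) (by rw [abs_neg, abs_of_pos hε])
  have := h.2 e1 e2 ⟨1/2, 1/2, by norm_num, by norm_num, by norm_num, by
    ext j
    simp [Pi.single_apply]
    split_ifs <;> ring⟩
  have := congrFun this i
  simp [Pi.single_apply, hik] at this
  exact hε.ne' this

/-- The point on the edge. -/
noncomputable def pt {m : ℕ} (a b : Fin m → ℝ) (p : Finset (Fin m) × Fin m) : Fin m → ℝ :=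
  Function.update (fun i => if i ∈ p.1 then b i else a i) p.2 (a p.2 + (1 - vs a b p.1))

lemma pt_sum {m : ℕ} (a b : Fin m → ℝ) (A : Finset (Fin m)) (j : Fin m) (hj : j ∉ A) :
    ∑ i, pt a b (A, j) i = 1 := by
  unfold pt
  rw [Finset.sum_update_of_mem (Finset.mem_univ j)]
  have : vs a b A = a j + ∑ i ∈ Finset.univ \ {j}, (if i ∈ A then b i else a i) := by
    unfold vs
    rw [← Finset.add_sum_erase _ _ (Finset.mem_univ j), Finset.sdiff_singleton_eq_erase]
    simp [hj]
  simp only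
  linarith

lemma pt_unique {m : ℕ} (a b : Fin m → ℝ) (A : Finset (Fin m)) (j : Fin m) (hj : j ∉ A)
    (ξ : Fin m → ℝ) (hs : ∑ i, ξ i = 1)
    (h : ∀ i, i ≠ j → ξ i = if i ∈ A then b i else a i) : pt a b (A, j) = ξ := by
  have e : ∀ i, i ≠ j → pt a b (A, j) i = ξ i := by
    intro i hi
    rw [h i hi]
    simp [pt, Function.update_of_ne hi]
  have h1 := pt_sum a b A j hj
  rw [← Finset.add_sum_erase _ _ (Finset.mem_univ j)] at h1 hs
  rw [Finset.sum_congr rfl (fun i hi => e i (Finset.ne_of_mem_erase hi))] at h1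
  ext i
  by_cases hi : i = j
  · subst hi; linarith
  · exact e i hi

lemma main {m : ℕ} (a b : Fin m → ℝ) (hab : ∀ j, a j ≤ b j) :
    ∃ F : Finset (Fin m → ℝ), F.card ≤ (m / 2 + 1) * m.choose (m / 2 + 1) ∧
      P a b = convexHull ℝ (F : Set (Fin m → ℝ)) := by
  classical
  rcases Set.eq_empty_or_nonempty (P a b) with hP | ⟨ξ₀, hξ₀⟩
  · exact ⟨∅, by simp, by simp [hP]⟩
  have hm : 0 < m := by
    rcases Nat.eq_zero_or_pos m with rfl | h
    · have := hξ₀.2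
      simp at this
    · exact h
  have hv0 : vs a b ∅ = ∑ i, a i := by simp [vs]
  by_cases h0 : vs a b ∅ < 1
  · let D : Finset (Finset (Fin m)) := Finset.univ.filter (fun A => vs a b A < 1)
    have memD : ∀ A, A ∈ D ↔ vs a b A < 1 := by simp [D]
    refine ⟨(edges D).image (pt a b), Finset.card_image_le.trans (card_edges_le D ?_),
      P_eq_hull a b _ ?_ ?_⟩
    · intro A j hj
      rw [memD, memD, vs_insert a b A j hj]
      intro h
      linarith [hab j]
    · intro ξ hξ
      simp only [Finset.coe_image, Set.mem_image, Finset.mem_coe, edges, Finset.mem_filter,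
        Finset.mem_univ, true_and, memD] at hξ
      obtain ⟨⟨A, j⟩, ⟨hA, hj, hB⟩, rfl⟩ := hξ
      simp only at hA hj hB
      rw [vs_insert a b A j hj] at hB
      refine ⟨fun i => ?_, pt_sum a b A j hj⟩
      by_cases hi : i = j
      · subst hi
        simp [pt]
        constructor <;> linarith
      · simp only [pt, Function.update_of_ne hi]
        split_ifs
        · exact ⟨hab i, le_rfl⟩
        · exact ⟨le_rfl, hab i⟩
    · intro ξ hξ
      simp only [Finset.coe_image, Set.mem_image, Finset.mem_coe]
      obtain ⟨hbox, hsum⟩ := hξ.1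
      let A : Finset (Fin m) := Finset.univ.filter (fun i => a i < ξ i ∧ ξ i = b i)
      -- it suffices to find a suitable coordinate
      have fin : ∀ (B : Finset (Fin m)) (j : Fin m), j ∉ B → a j < ξ j →
          (∀ i, i ≠ j → ξ i = if i ∈ B then b i else a i) →
          ∃ p ∈ edges D, pt a b p = ξ := by
        intro B j hj haj h
        have hp := pt_unique a b B j hj ξ hsum h
        refine ⟨(B, j), ?_, hp⟩
        have hval : ξ j = a j + (1 - vs a b B) := by
          rw [← hp]; simp [pt]
        simp only [edges, Finset.mem_filter, Finset.mem_univ, true_and, memD,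
          vs_insert a b B j hj]
        refine ⟨by linarith, hj, ?_⟩
        have := (hbox j).2
        linarith
      by_cases hmid : ∃ j, a j < ξ j ∧ ξ j < b j
      · obtain ⟨j, hj⟩ := hmid
        refine fin A j (by simp [A, hj.1, hj.2.ne]) hj.1 ?_
        intro i hi
        have hni : ¬ (a i < ξ i ∧ ξ i < b i) := fun h =>
          hi (extreme_interior a b ξ hξ i j h hj)
        have h1 := (hbox i).1
        have h2 := (hbox i).2
        by_cases hia : a i < ξ i
        · have : ξ i = b i := le_antisymm h2 (not_lt.1 fun h => hni ⟨hia, h⟩)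
          rw [if_pos (by simp only [A, Finset.mem_filter, Finset.mem_univ, true_and]
                         exact ⟨hia, this⟩)]
          exact this
        · rw [if_neg (by simp [A, hia])]
          linarith
      · push Not at hmid
        have hex : ∃ j, a j < ξ j := by
          by_contra hcon
          push Not at hcon
          have : ∑ i, ξ i ≤ ∑ i, a i := Finset.sum_le_sum fun i _ => hcon i
          linarith
        obtain ⟨j, hj⟩ := hex
        refine fin (A.erase j) j (by simp) hj ?_
        intro i hi
        have h1 := (hbox i).1
        have h2 := (hbox i).2
        by_cases hia : a i < ξ i
        · have : ξ i = b i := le_antisymm h2 (hmid i hia)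
          rw [if_pos (by simp only [A, Finset.mem_erase, Finset.mem_filter, Finset.mem_univ,
                           true_and]
                         exact ⟨hi, hia, this⟩)]
          exact this
        · rw [if_neg (by simp [A, hia])]
          linarith
  · have hall : ∀ ξ ∈ P a b, ξ = a := by
      intro ξ hξ
      have h1 : ∑ i, a i = ∑ i, ξ i := by
        apply le_antisymm
        · exact Finset.sum_le_sum fun i _ => (hξ.1 i).1
        · rw [hξ.2]; linarith
      have := (Finset.sum_eq_sum_iff_of_le (fun i _ => (hξ.1 i).1)).1 h1
      ext i
      exact (this i (Finset.mem_univ i)).symm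
    refine ⟨{a}, ?_, P_eq_hull a b _ ?_ ?_⟩
    · rw [Finset.card_singleton]
      exact Nat.mul_pos (Nat.succ_pos _) (Nat.choose_pos (by omega))
    · simp only [Finset.coe_singleton, Set.singleton_subset_iff]
      exact hall ξ₀ hξ₀ ▸ hξ₀
    · intro ξ hξ
      simp [hall ξ hξ.1]

end CIH

/-- A bounded convex interval hull built from closed intervals is the convex
hull of at most `n * C(m, n)` points, where `n = ⌊m/2⌋ + 1`. -/
theorem convex_interval_hull_vertex_bound {L : Type*} [NormedAddCommGroup L]
    [NormedSpace ℝ L] (m : ℕ) (x : Fin m → L) (a b : Fin m → ℝ)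
    (hab : ∀ j, a j ≤ b j)
    (hbdd : Bornology.IsBounded {y : L | ∃ ξ : Fin m → ℝ,
      (∀ j, ξ j ∈ Set.Icc (a j) (b j)) ∧ (∑ j, ξ j) = 1 ∧ y = ∑ j, ξ j • x j})
    (n : ℕ) (hn : n = m / 2 + 1) :
    ∃ F : Finset L, F.card ≤ n * Nat.choose m n ∧
      {y : L | ∃ ξ : Fin m → ℝ,
        (∀ j, ξ j ∈ Set.Icc (a j) (b j)) ∧ (∑ j, ξ j) = 1 ∧ y = ∑ j, ξ j • x j} =
      convexHull ℝ (F : Set L) := by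
  classical
  subst hn
  obtain ⟨F, hF, hP⟩ := CIH.main a b hab
  let T : (Fin m → ℝ) →ₗ[ℝ] L := Fintype.linearCombination ℝ x
  have hT : ∀ ξ, T ξ = ∑ j, ξ j • x j := fun ξ => Fintype.linearCombination_apply ℝ x ξ
  refine ⟨F.image T, Finset.card_image_le.trans hF, ?_⟩
  rw [Finset.coe_image, ← LinearMap.image_convexHull, ← hP]
  ext y
  simp only [Set.mem_ofPred_eq, Set.mem_image, CIH.P, hT]
  constructor
  · rintro ⟨ξ, h1, h2, h3⟩
    exact ⟨ξ, ⟨h1, h2⟩, h3.symm⟩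
  · rintro ⟨ξ, ⟨h1, h2⟩, h3⟩
    exact ⟨ξ, h1, h2, h3.symm⟩
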